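/- For natural numbers a, b, c, d, the number of natural numbers e such that the triples (a,b,e) and (e,c,d) both satisfy the triangle conditions (Δ) equals the number of natural numbers f such that the triples (a,c,f) and (f,b,d) both satisfy (Δ). -/

import Mathlib

/-- The triangle conditions (Δ). -/
def DeltaCond (a b c : ℕ) : Prop :=
  a ≤ b + c ∧ b ≤ c + a ∧ c ≤ a + b ∧ Even (a + b + c)

/-- Lower end of the range of intermediate labels. -/
def lowEnd (a b c d : ℕ) : ℕ := max (max (a - b) (b - a)) (max (c - d) (d - c))

/-- Upper end of the range of intermediate labels. -/
def highEnd (a b c d : ℕ) : ℕ := min (a + b) (c + d)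

lemma deltaCond_pair_iff (a b c d e : ℕ) :
    (DeltaCond a b e ∧ DeltaCond e c d) ↔
      lowEnd a b c d ≤ e ∧ e ≤ highEnd a b c d ∧ (a + b + e) % 2 = 0 ∧
        (a + b + c + d) % 2 = 0 := by
  unfold DeltaCond lowEnd highEnd
  simp only [Nat.even_iff, max_le_iff, le_min_iff]
  omega

lemma ends_symm (a b c d : ℕ) :
    highEnd a b c d + lowEnd a c b d = highEnd a c b d + lowEnd a b c d := by
  unfold lowEnd highEnd
  omega

lemma lowEnd_parity (a b c d : ℕ) (h : (a + b + c + d) % 2 = 0) :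
    (a + b + lowEnd a b c d) % 2 = 0 := by
  unfold lowEnd
  omega

lemma shift_mem (a b c d e : ℕ) (h : DeltaCond a b e ∧ DeltaCond e c d) :
    DeltaCond a c (e + lowEnd a c b d - lowEnd a b c d) ∧
      DeltaCond (e + lowEnd a c b d - lowEnd a b c d) b d := by
  rw [deltaCond_pair_iff] at h ⊢
  have h1 := ends_symm a b c d
  have h2 := lowEnd_parity a b c d (by omega)
  have h3 := lowEnd_parity a c b d (by omega)
  omega

/-- the number of `e` with `(a,b,e)` and `(e,c,d)` admissible equals the
number of `f` with `(a,c,f)` and `(f,b,d)` admissible. -/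
theorem count_intermediate_labels (a b c d : ℕ) :
    Nat.card {e : ℕ // DeltaCond a b e ∧ DeltaCond e c d} =
      Nat.card {f : ℕ // DeltaCond a c f ∧ DeltaCond f b d} := by
  refine Nat.card_congr
    { toFun := fun e => ⟨_, shift_mem a b c d e.1 e.2⟩
      invFun := fun f => ⟨_, shift_mem a c b d f.1 f.2⟩
      left_inv := ?_
      right_inv := ?_ }
  · rintro ⟨e, he⟩
    have h := (deltaCond_pair_iff a b c d e).1 he
    apply Subtype.ext
    simp only
    omega
  · rintro ⟨e, he⟩
    have h := (deltaCond_pair_iff a c b d e).1 he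
    apply Subtype.ext
    simp only
    omega
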